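/- Fix γ > 0 and β < 0, and let m(k) = √(tanh(k)/k) for k > 0. Then there exists a unique k_c > 0 satisfying k_c²·(√(tanh(k_c)/k_c) − √(tanh(2k_c)/(2k_c))) = 3γ/(4|β|); moreover, the modulational instability index Δ(k) = (c_p(k) − c_p(2k))·c_g'(k) of the Ostrovsky–Whitham equation satisfies Δ(k) > 0 for 0 < k < k_c and Δ(k) < 0 for k > k_c. -/

import Mathlib

/-- The derivative of `tanh` is `1 - tanh ^ 2`. -/
theorem Real.hasDerivAt_tanh_one_sub_sq (x : ℝ) :
    HasDerivAt Real.tanh (1 - Real.tanh x ^ 2) x := by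
  have hc := (Real.cosh_pos x).ne'
  have h := (Real.hasDerivAt_sinh x).div (Real.hasDerivAt_cosh x) hc
  have he : Real.tanh = Real.sinh / Real.cosh := by
    ext y
    exact Real.tanh_eq_sinh_div_cosh y
  rw [Real.tanh_eq_sinh_div_cosh, he]
  refine h.congr_deriv ?_
  field_simp

theorem Real.strictMono_tanh_of_deriv : StrictMono Real.tanh :=
  strictMono_of_deriv_pos fun x => by
    rw [(Real.hasDerivAt_tanh_one_sub_sq x).deriv]
    linarith [Real.tanh_sq_lt_one x]

theorem Real.tanh_pos_of_pos {x : ℝ} (hx : 0 < x) : 0 < Real.tanh x := by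
  simpa using Real.strictMono_tanh_of_deriv hx

theorem Real.tanh_two_mul_eq (x : ℝ) :
    Real.tanh (2 * x) = 2 * Real.tanh x / (1 + Real.tanh x ^ 2) := by
  have hc := Real.cosh_pos x
  have hd : 0 < Real.cosh x ^ 2 + Real.sinh x ^ 2 := by positivity
  simp only [Real.tanh_eq_sinh_div_cosh, Real.sinh_two_mul, Real.cosh_two_mul]
  field_simp

namespace OstrovskyWhitham

/-- The function `k ^ 2 * (m k - m (2 * k))`, in a product form that is regular at `0`. -/
noncomputable def dispersionGap (k : ℝ) : ℝ :=
  k * Real.sqrt (k * Real.tanh k) * (1 - 1 / Real.sqrt (1 + Real.tanh k ^ 2))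

theorem sqrt_mul_tanh {k : ℝ} (hk : 0 < k) :
    Real.sqrt (k * Real.tanh k) = k * Real.sqrt (Real.tanh k / k) := by
  have h : k * Real.tanh k = k ^ 2 * (Real.tanh k / k) := by field_simp
  rw [h, Real.sqrt_mul (sq_nonneg k), Real.sqrt_sq hk.le]

theorem dispersionGap_eq {k : ℝ} (hk : 0 < k) :
    k ^ 2 * (Real.sqrt (Real.tanh k / k) - Real.sqrt (Real.tanh (2 * k) / (2 * k))) =
      dispersionGap k := by
  have ht := Real.tanh_pos_of_pos hk
  have h : Real.tanh (2 * k) / (2 * k) = Real.tanh k / k / (1 + Real.tanh k ^ 2) := by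
    rw [Real.tanh_two_mul_eq]
    field_simp
  rw [h, Real.sqrt_div (div_pos ht hk).le (1 + _), dispersionGap, sqrt_mul_tanh hk]
  ring

theorem one_sub_one_div_sqrt_pos {t : ℝ} (ht : 0 < t) : 0 < 1 - 1 / Real.sqrt (1 + t ^ 2) := by
  have h : 1 < Real.sqrt (1 + t ^ 2) := by
    rw [Real.lt_sqrt zero_le_one]
    nlinarith
  rw [sub_pos, div_lt_one (by linarith)]
  exact h

theorem dispersionGap_pos {k : ℝ} (hk : 0 < k) : 0 < dispersionGap k := by
  have ht := Real.tanh_pos_of_pos hk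
  have h := one_sub_one_div_sqrt_pos ht
  unfold dispersionGap
  positivity

theorem div_mul_dispersionGap_le {a b : ℝ} (ha : 0 < a) (hab : a ≤ b) :
    b / a * dispersionGap a ≤ dispersionGap b := by
  have ht := Real.tanh_pos_of_pos ha
  have htb := Real.strictMono_tanh_of_deriv.monotone hab
  have h := one_sub_one_div_sqrt_pos ht
  have hb : 0 < b := ha.trans_le hab
  calc
    b / a * dispersionGap a = b * Real.sqrt (a * Real.tanh a) *
        (1 - 1 / Real.sqrt (1 + Real.tanh a ^ 2)) := by
      unfold dispersionGap
      field_simp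
    _ ≤ dispersionGap b := by
      unfold dispersionGap
      gcongr

theorem dispersionGap_lt {a b : ℝ} (ha : 0 < a) (hab : a < b) :
    dispersionGap a < dispersionGap b :=
  (lt_mul_of_one_lt_left (dispersionGap_pos ha) ((one_lt_div ha).2 hab)).trans_le
    (div_mul_dispersionGap_le ha hab.le)

theorem continuous_dispersionGap : Continuous dispersionGap := by
  have h : Continuous Real.tanh := continuous_iff_continuousAt.2 fun x =>
    (Real.hasDerivAt_tanh_one_sub_sq x).continuousAt
  unfold dispersionGap
  refine (continuous_id.mul (continuous_id.mul h).sqrt).mul (continuous_const.sub ?_)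
  exact continuous_const.div (by fun_prop) fun x => by positivity

theorem exists_dispersionGap_eq {C : ℝ} (hC : 0 < C) : ∃ k, 0 < k ∧ dispersionGap k = C := by
  have h1 := dispersionGap_pos one_pos
  set K := max 1 (C / dispersionGap 1)
  have hK : C ≤ dispersionGap K := by
    have h := div_mul_dispersionGap_le one_pos (le_max_left 1 (C / dispersionGap 1))
    rw [div_one] at h
    exact ((div_le_iff₀ h1).1 (le_max_right _ _)).trans h
  have h0 : dispersionGap 0 = 0 := by simp [dispersionGap]
  obtain ⟨k, hk, hkC⟩ := intermediate_value_Icc (zero_le_one.trans (le_max_left 1 _))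
    continuous_dispersionGap.continuousOn ⟨h0.trans_le hC.le, hK⟩
  refine ⟨k, hk.1.lt_of_ne ?_, hkC⟩
  rintro rfl
  exact hC.ne (h0.symm.trans hkC)

theorem hasDerivAt_mul_tanh (x : ℝ) :
    HasDerivAt (fun y => y * Real.tanh y) (Real.tanh x + x * (1 - Real.tanh x ^ 2)) x := by
  simpa using (hasDerivAt_id' x).fun_mul (Real.hasDerivAt_tanh_one_sub_sq x)

theorem hasDerivAt_sqrt_mul_tanh {x : ℝ} (hx : 0 < x) :
    HasDerivAt (fun y => Real.sqrt (y * Real.tanh y))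
      ((Real.tanh x + x * (1 - Real.tanh x ^ 2)) / (2 * Real.sqrt (x * Real.tanh x))) x :=
  (hasDerivAt_mul_tanh x).sqrt (mul_pos hx (Real.tanh_pos_of_pos hx)).ne'

/-- The derivative of `k * m k`, for `m k = √(tanh k / k)`. -/
theorem add_mul_deriv_sqrt_tanh_div {x : ℝ} (hx : 0 < x) :
    Real.sqrt (Real.tanh x / x) + x * deriv (fun k => Real.sqrt (Real.tanh k / k)) x =
      (Real.tanh x + x * (1 - Real.tanh x ^ 2)) / (2 * Real.sqrt (x * Real.tanh x)) := by
  have hm : DifferentiableAt ℝ (fun k => Real.sqrt (Real.tanh k / k)) x :=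
    ((Real.hasDerivAt_tanh_one_sub_sq x).differentiableAt.div differentiableAt_id hx.ne').sqrt
      (div_pos (Real.tanh_pos_of_pos hx) hx).ne'
  have h := (hasDerivAt_id x).mul hm.hasDerivAt
  have heq : (fun y => Real.sqrt (y * Real.tanh y)) =ᶠ[nhds x]
      id * fun k => Real.sqrt (Real.tanh k / k) := by
    filter_upwards [lt_mem_nhds hx] with y hy
    exact sqrt_mul_tanh hy
  simpa using (h.congr_of_eventuallyEq heq).unique (hasDerivAt_sqrt_mul_tanh hx)

/-- The function `k ↦ √(k * tanh k)` has negative second derivative on `(0, ∞)`. -/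
theorem exists_hasDerivAt_deriv_sqrt_mul_tanh_neg {x : ℝ} (hx : 0 < x) :
    ∃ d < 0, HasDerivAt (fun y => (Real.tanh y + y * (1 - Real.tanh y ^ 2)) /
      (2 * Real.sqrt (y * Real.tanh y))) d x := by
  have ht := Real.tanh_pos_of_pos hx
  have hs : 0 < 1 - Real.tanh x ^ 2 := by linarith [Real.tanh_sq_lt_one x]
  have hw : 0 < Real.sqrt (x * Real.tanh x) := Real.sqrt_pos.2 (mul_pos hx ht)
  have hw2 : Real.sqrt (x * Real.tanh x) ^ 2 = x * Real.tanh x := Real.sq_sqrt (by positivity)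
  have hT := Real.hasDerivAt_tanh_one_sub_sq x
  have h := (hT.add ((hasDerivAt_id x).mul ((hT.pow 2).const_sub 1))).div
    ((hasDerivAt_sqrt_mul_tanh hx).const_mul 2) (by positivity)
  refine ⟨_, ?_, h⟩
  simp only [Pi.add_apply, Pi.mul_apply, Pi.pow_apply, id]
  refine div_neg_of_neg_of_pos ?_ (by positivity)
  set w := Real.sqrt (x * Real.tanh x)
  set t := Real.tanh x
  have key : 2 * w ^ 2 * (2 * (1 - t ^ 2) * (1 - x * t)) - (t + x * (1 - t ^ 2)) ^ 2 < 0 := by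
    have h1 : 0 < 4 * (x * t) ^ 2 * (1 - t ^ 2) := by positivity
    rw [hw2]
    nlinarith [sq_nonneg (t - x * (1 - t ^ 2))]
  refine lt_of_eq_of_lt ?_ (div_neg_of_neg_of_pos key hw)
  field_simp
  push_cast
  ring

/-- The group velocity of the Ostrovsky–Whitham equation is increasing for `β < 0 < γ`. -/
theorem deriv_groupVelocity_pos {γ β k : ℝ} (hγ : 0 < γ) (hβ : β < 0) (hk : 0 < k) :
    0 < deriv (fun k => β * (Real.sqrt (Real.tanh k / k) +
      k * deriv (fun k => Real.sqrt (Real.tanh k / k)) k) - γ / k ^ 2) k := by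
  obtain ⟨d, hd, h⟩ := exists_hasDerivAt_deriv_sqrt_mul_tanh_neg hk
  have hg := (h.const_mul β).sub
    ((hasDerivAt_const k γ).div (hasDerivAt_pow 2 k) (by positivity))
  have heq : (fun k => β * (Real.sqrt (Real.tanh k / k) +
      k * deriv (fun k => Real.sqrt (Real.tanh k / k)) k) - γ / k ^ 2) =ᶠ[nhds k]
      (fun y => β * ((Real.tanh y + y * (1 - Real.tanh y ^ 2)) /
        (2 * Real.sqrt (y * Real.tanh y)))) - (fun _ => γ) / fun y => y ^ 2 := by
    filter_upwards [lt_mem_nhds hk] with y hy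
    simp only [Pi.sub_apply, Pi.div_apply, add_mul_deriv_sqrt_tanh_div hy]
  rw [(hg.congr_of_eventuallyEq heq).deriv]
  have h1 : 0 < β * d := mul_pos_of_neg_of_neg hβ hd
  have h2 : (0 * k ^ 2 - γ * (((2 : ℕ) : ℝ) * k ^ (2 - 1))) / (k ^ 2) ^ 2 < 0 :=
    div_neg_of_neg_of_pos (by norm_num; positivity) (by positivity)
  linarith

theorem phaseVelocity_sub {γ β k : ℝ} (hβ : β < 0) (hk : 0 < k) :
    β * Real.sqrt (Real.tanh k / k) + γ / k ^ 2 -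
        (β * Real.sqrt (Real.tanh (2 * k) / (2 * k)) + γ / (2 * k) ^ 2) =
      -β / k ^ 2 * (3 * γ / (4 * |β|) - dispersionGap k) := by
  rw [← dispersionGap_eq hk, abs_of_neg hβ]
  have := hβ.ne
  field_simp
  ring

end OstrovskyWhitham

/-- For the Ostrovsky–Whitham equation (symbol `m(k) = √(tanh(k)/k)`) with
`γ > 0`, `β < 0`: there is a unique `k_c > 0` with
`k_c²·(√(tanh(k_c)/k_c) − √(tanh(2k_c)/(2k_c))) = 3γ/(4|β|)`, and the modulational
instability index `Δ(k) = (c_p(k) − c_p(2k))·c_g'(k)` satisfies `Δ(k) > 0` for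
`0 < k < k_c` and `Δ(k) < 0` for `k > k_c`. -/
theorem stmt_11 (γ β : ℝ) (hγ : 0 < γ) (hβ : β < 0) :
    let m : ℝ → ℝ := fun k => Real.sqrt (Real.tanh k / k)
    let cp : ℝ → ℝ := fun k => β * m k + γ / k ^ 2
    let cg : ℝ → ℝ := fun k => β * (m k + k * deriv m k) - γ / k ^ 2
    let Δ : ℝ → ℝ := fun k => (cp k - cp (2 * k)) * deriv cg k
    ∃ kc : ℝ, 0 < kc ∧
      kc ^ 2 * (Real.sqrt (Real.tanh kc / kc) -
        Real.sqrt (Real.tanh (2 * kc) / (2 * kc))) = 3 * γ / (4 * |β|) ∧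
      (∀ k : ℝ, 0 < k →
        k ^ 2 * (Real.sqrt (Real.tanh k / k) -
          Real.sqrt (Real.tanh (2 * k) / (2 * k))) = 3 * γ / (4 * |β|) → k = kc) ∧
      (∀ k : ℝ, 0 < k → k < kc → 0 < Δ k) ∧
      (∀ k : ℝ, kc < k → Δ k < 0) := by
  intro m cp cg Δ
  have hC : 0 < 3 * γ / (4 * |β|) := by
    have := abs_pos.2 hβ.ne
    positivity
  obtain ⟨kc, hkc, hkcC⟩ := OstrovskyWhitham.exists_dispersionGap_eq hC
  have hΔ (k : ℝ) : Δ k = (cp k - cp (2 * k)) * deriv cg k := rfl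
  have hcp {k : ℝ} (hk : 0 < k) : cp k - cp (2 * k) =
      -β / k ^ 2 * (OstrovskyWhitham.dispersionGap kc - OstrovskyWhitham.dispersionGap k) := by
    rw [hkcC]
    exact OstrovskyWhitham.phaseVelocity_sub hβ hk
  have hcg {k : ℝ} (hk : 0 < k) : 0 < deriv cg k :=
    OstrovskyWhitham.deriv_groupVelocity_pos hγ hβ hk
  have hβk {k : ℝ} (hk : 0 < k) : 0 < -β / k ^ 2 := div_pos (neg_pos.2 hβ) (by positivity)
  refine ⟨kc, hkc, ?_, fun k hk hkC => ?_, fun k hk hlt => ?_, fun k hlt => ?_⟩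
  · rw [OstrovskyWhitham.dispersionGap_eq hkc, hkcC]
  · rw [OstrovskyWhitham.dispersionGap_eq hk, ← hkcC] at hkC
    rcases lt_trichotomy k kc with h | h | h
    · exact absurd hkC (OstrovskyWhitham.dispersionGap_lt hk h).ne
    · exact h
    · exact absurd hkC (OstrovskyWhitham.dispersionGap_lt hkc h).ne'
  · rw [hΔ, hcp hk]
    exact mul_pos (mul_pos (hβk hk)
      (sub_pos.2 (OstrovskyWhitham.dispersionGap_lt hk hlt))) (hcg hk)
  · have hk := hkc.trans hlt
    rw [hΔ, hcp hk]
    exact mul_neg_of_neg_of_pos (mul_neg_of_pos_of_neg (hβk hk)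
      (sub_neg.2 (OstrovskyWhitham.dispersionGap_lt hkc hlt))) (hcg hk)
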